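/- Let $0<m<n$, $s\ge 0$ integers, $k,h\in\mathbb{Z}$, and consider on $\mathbb{R}^s\times\mathbb{R}^m\times\mathbb{C}^{n-m}$ (coordinates $(\rho,\eta,w)$, Lebesgue measure) the kernel $K\{0,k,h,s\}(\rho,\eta,w,\epsilon)=\big(\epsilon+\sum_{i=1}^s|\rho_i|+\sum_{i=1}^m|\eta_i|+\sum_{i=1}^{n-m}|w_i|\big)^{-k}\big(\sqrt{\epsilon}+\sum_{i=1}^s\sqrt{|\rho_i|}+\sum_{i=1}^m\sqrt{|\eta_i|}+\sum_{i=1}^{n-m}|w_i|\big)^{-2h}$ and $\mathcal{I}_1\{0,k,h,s\}(\epsilon,\delta)=\int_{\mathbf{V}(\delta)}K\{0,k,h,s\}(\rho,\eta,w,\epsilon)\,d\lambda$. If $k\le 2n-2m-1$ and $k+2(h-s)\le 2n-1$, then there exists $C>0$ such that for all $\epsilon\in(0,1)$ and all $\delta\in(0,1)$ one has $\mathcal{I}_1\{0,k,h,s\}(\epsilon,\delta)\le C\,\delta$. -/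

import Mathlib

open MeasureTheory
lemma pw_bound (A B Pw Pu L t : ℝ) (d e : ℕ) (k h : ℤ) (hd : 1 ≤ d)
    (hA : 0 < A) (hAB : A ≤ B) (hBL : B ≤ L) (hL : 1 ≤ L)
    (hPw : 0 < Pw) (hPwA : Pw ≤ A ^ d) (hPu : 0 < Pu) (hPuB : Pu ≤ B ^ e)
    (ht : t = 2 - 1 / ((d : ℝ) + e))
    (hk : k ≤ 2 * (d : ℤ) - 1) (hkh : k + 2 * h ≤ 2 * ((d : ℤ) + e) - 1) :
    A ^ (-k) * B ^ (-(2 * h)) ≤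
      L ^ (2 * ((d : ℝ) + e) - 1 - k - 2 * h) * (Pw ^ (-t) * Pu ^ (-t)) := by
  have hB : 0 < B := hA.trans_le hAB
  have hd' : (1 : ℝ) ≤ d := by exact_mod_cast hd
  have he' : (0 : ℝ) ≤ e := by positivity
  have hk' : (k : ℝ) ≤ 2 * d - 1 := by exact_mod_cast hk
  have hkh' : (k : ℝ) + 2 * h ≤ 2 * ((d : ℝ) + e) - 1 := by exact_mod_cast hkh
  have hQ : (0 : ℝ) < (d : ℝ) + e := by positivity
  have hQ1 : 1 / ((d : ℝ) + e) ≤ 1 / d := by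
    apply one_div_le_one_div_of_le <;> linarith
  have hd1 : 1 / (d : ℝ) ≤ 1 := by
    rw [div_le_one (by linarith)]; exact hd'
  have ht1 : 1 ≤ t := by linarith
  have htQ : t * ((d : ℝ) + e) = 2 * ((d : ℝ) + e) - 1 := by
    rw [ht]; field_simp
  have hkt : (k : ℝ) / d ≤ t := by
    have : (k : ℝ) / d ≤ 2 - 1 / d := by
      rw [div_le_iff₀ (by linarith)]
      have : (2 - 1 / (d : ℝ)) * d = 2 * d - 1 := by field_simp
      linarith
    linarith
  have hPwB : Pw ≤ B ^ d := hPwA.trans (pow_le_pow_left₀ hA.le hAB d)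
  have h1 : Pw ^ t ≤ A ^ (k : ℝ) * B ^ (d * t - k) := by
    rcases le_total k 0 with hk0 | hk0
    · have hk0' : (k : ℝ) ≤ 0 := by exact_mod_cast hk0
      calc Pw ^ t ≤ (B ^ d) ^ t := Real.rpow_le_rpow hPw.le hPwB (by linarith)
        _ = B ^ (k : ℝ) * B ^ (d * t - k) := by
          rw [← Real.rpow_natCast, ← Real.rpow_mul hB.le, ← Real.rpow_add hB]
          congr 1; ring
        _ ≤ _ := by
          gcongr ?_ * _
          exact Real.rpow_le_rpow_of_nonpos hA hAB hk0'
    · have hk0' : (0 : ℝ) ≤ k := by exact_mod_cast hk0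
      calc Pw ^ t = Pw ^ ((k : ℝ) / d) * Pw ^ (t - k / d) := by
            rw [← Real.rpow_add hPw]; congr 1; ring
        _ ≤ (A ^ d) ^ ((k : ℝ) / d) * (B ^ d) ^ (t - k / d) := by
          gcongr
        _ = _ := by
          rw [← Real.rpow_natCast, ← Real.rpow_natCast, ← Real.rpow_mul hB.le,
            ← Real.rpow_mul hA.le]
          congr 2 <;> field_simp
  have h2 : Pu ^ t ≤ B ^ (e * t) := by
    rw [Real.rpow_mul hB.le, Real.rpow_natCast]
    exact Real.rpow_le_rpow hPu.le hPuB (by linarith)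
  have h3 : A ^ (-k) * B ^ (-(2 * h)) * (Pw ^ t * Pu ^ t) ≤
      L ^ (2 * ((d : ℝ) + e) - 1 - k - 2 * h) := by
    rw [← Real.rpow_intCast, ← Real.rpow_intCast]
    push_cast
    calc A ^ (-(k : ℝ)) * B ^ (-(2 * (h : ℝ))) * (Pw ^ t * Pu ^ t)
        ≤ A ^ (-(k : ℝ)) * B ^ (-(2 * (h : ℝ))) *
          ((A ^ (k : ℝ) * B ^ (d * t - k)) * B ^ (e * t)) := by gcongr
      _ = (A ^ (-(k : ℝ)) * A ^ (k : ℝ)) *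
          (B ^ (-(2 * (h : ℝ))) * B ^ (d * t - k) * B ^ (e * t)) := by ring
      _ = B ^ (2 * ((d : ℝ) + e) - 1 - k - 2 * h) := by
        rw [← Real.rpow_add hA, ← Real.rpow_add hB, ← Real.rpow_add hB, ← htQ]
        simp only [neg_add_cancel, Real.rpow_zero, one_mul]
        congr 1; ring
      _ ≤ _ := Real.rpow_le_rpow hB.le hBL (by linarith)
  rw [Real.rpow_neg hPw.le, Real.rpow_neg hPu.le, ← mul_inv, ← div_eq_mul_inv,
    le_div_iff₀ (by positivity)]
  exact h3

lemma radial {E : Type*} [NormedAddCommGroup E] [NormedSpace ℝ E] [FiniteDimensional ℝ E]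
    [Nontrivial E] [MeasurableSpace E] [BorelSpace E] (μ : Measure E) [μ.IsAddHaarMeasure]
    (c : ℝ) (hc : c < Module.finrank ℝ E) :
    ∃ C : ℝ, 0 ≤ C ∧ ∀ R > (0 : ℝ),
      Integrable (fun x : E => (Set.Iio R).indicator (fun y : ℝ => y ^ (-c)) ‖x‖) μ ∧
      ∫ x : E, (Set.Iio R).indicator (fun y : ℝ => y ^ (-c)) ‖x‖ ∂μ =
        C * R ^ ((Module.finrank ℝ E : ℝ) - c) := by
  have hdim : 1 ≤ Module.finrank ℝ E := Module.finrank_pos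
  set D := Module.finrank ℝ E with hD
  have key : ∀ R : ℝ, ∀ y ∈ Set.Ioi (0 : ℝ),
      y ^ (D - 1) • (Set.Iio R).indicator (fun y : ℝ => y ^ (-c)) y =
      (Set.Iio R).indicator (fun y : ℝ => y ^ ((D : ℝ) - 1 - c)) y := by
    intro R y hy
    have hy : 0 < y := hy
    by_cases h : y ∈ Set.Iio R
    · rw [Set.indicator_of_mem h, Set.indicator_of_mem h, smul_eq_mul, ← Real.rpow_natCast,
        ← Real.rpow_add hy]
      congr 1
      push_cast [Nat.cast_sub hdim]
      ring
    · rw [Set.indicator_of_notMem h, Set.indicator_of_notMem h, smul_zero]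
  refine ⟨D * μ.real (Metric.ball 0 1) * (1 / ((D : ℝ) - c)), ?_, fun R hR => ⟨?_, ?_⟩⟩
  · have : 0 < (D : ℝ) - c := by linarith
    positivity
  · rw [integrable_fun_norm_addHaar μ (f := (Set.Iio R).indicator (fun y : ℝ => y ^ (-c))),
      integrableOn_congr_fun (key R) measurableSet_Ioi, integrableOn_indicator_iff measurableSet_Iio,
      Set.Iio_inter_Ioi, intervalIntegral.integrableOn_Ioo_rpow_iff hR]
    linarith
  · rw [integral_fun_norm_addHaar μ (f := (Set.Iio R).indicator (fun y : ℝ => y ^ (-c))),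
      setIntegral_congr_fun measurableSet_Ioi (key R), setIntegral_indicator measurableSet_Iio,
      Set.Ioi_inter_Iio, ← integral_Ioc_eq_integral_Ioo,
      ← intervalIntegral.integral_of_le hR.le, integral_rpow (Or.inl (by linarith))]
    have h0 : (D : ℝ) - 1 - c + 1 = D - c := by ring
    rw [h0, Real.zero_rpow (by linarith)]
    simp only [nsmul_eq_mul, smul_eq_mul]
    ring

lemma prod_le_sum_pow {ι : Type*} [Fintype ι] (f : ι → ℝ) (hf : ∀ i, 0 ≤ f i) (S : ℝ)
    (hS : ∑ i, f i ≤ S) : ∏ i, f i ≤ S ^ (Fintype.card ι) := by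
  calc ∏ i, f i ≤ ∏ _i : ι, S := Finset.prod_le_prod (fun i _ => hf i) fun i _ =>
        (Finset.single_le_sum (fun j _ => hf j) (Finset.mem_univ i)).trans hS
    _ = _ := by simp

theorem I1_estimate_delta' (n m s : ℕ) (hm : 0 < m) (hmn : m < n) (k h : ℤ)
    (hk : k ≤ 2 * (n : ℤ) - 2 * (m : ℤ) - 1)
    (hkh : k + 2 * (h - (s : ℤ)) ≤ 2 * (n : ℤ) - 1) :
    ∃ C > (0 : ℝ),
      ∀ ε ∈ Set.Ioo (0 : ℝ) 1, ∀ δ ∈ Set.Ioo (0 : ℝ) 1,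
        (∫ x : (Fin s → ℝ) × (Fin m → ℝ) × (Fin (n - m) → ℂ) in
            {p : (Fin s → ℝ) × (Fin m → ℝ) × (Fin (n - m) → ℂ) |
              (∑ i, |p.1 i|) + (∑ i, |p.2.1 i|) + (∑ i, ‖p.2.2 i‖ ^ 2) < δ ^ 2},
          (ε + (∑ i, |x.1 i|) + (∑ i, |x.2.1 i|) + ∑ i, ‖x.2.2 i‖) ^ (-k) *
            (Real.sqrt ε + (∑ i, Real.sqrt |x.1 i|) + (∑ i, Real.sqrt |x.2.1 i|) +
              ∑ i, ‖x.2.2 i‖) ^ (-(2 * h)))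
        ≤ C * δ := by
  obtain ⟨d, rfl⟩ : ∃ d, n = m + d := ⟨n - m, by omega⟩
  have hd : 1 ≤ d := by omega
  rw [Nat.add_sub_cancel_left]
  obtain ⟨t, ht⟩ : ∃ t : ℝ, t = 2 - 1 / ((d : ℝ) + (s + m : ℕ)) := ⟨_, rfl⟩
  have hd' : (1 : ℝ) ≤ d := by exact_mod_cast hd
  have hQ : (0 : ℝ) < (d : ℝ) + (s + m : ℕ) := by positivity
  have ht2 : t < 2 := by
    have : 0 < 1 / ((d : ℝ) + (s + m : ℕ)) := by positivity
    linarith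
  have htQ : (2 - t) * ((d : ℝ) + (s + m : ℕ)) = 1 := by
    rw [ht]; field_simp; ring
  obtain ⟨c1, hc1, H1⟩ := radial (volume : Measure ℝ) (t / 2) (by simp; linarith)
  obtain ⟨c2, hc2, H2⟩ := radial (volume : Measure ℂ) t (by simpa using ht2)
  simp only [Module.finrank_self, Complex.finrank_real_complex, Nat.cast_one,
    Nat.cast_ofNat] at H1 H2
  obtain ⟨L, hLdef⟩ : ∃ L : ℝ, L = 1 + s + m + d := ⟨_, rfl⟩
  have hL : 1 ≤ L := by
    rw [hLdef]
    have : (0 : ℝ) ≤ s := by positivity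
    have : (0 : ℝ) ≤ m := by positivity
    linarith
  obtain ⟨C0, hC0def⟩ : ∃ C0 : ℝ,
    C0 = L ^ (2 * ((d : ℝ) + (s + m : ℕ)) - 1 - k - 2 * h) := ⟨_, rfl⟩
  have hC0 : 0 < C0 := by rw [hC0def]; positivity
  refine ⟨C0 * (c1 ^ s * (c1 ^ m * c2 ^ d)) + 1, by positivity, ?_⟩
  rintro ε ⟨hε0, hε1⟩ δ ⟨hδ0, hδ1⟩
  have hδ2 : 0 < δ ^ 2 := by positivity
  obtain ⟨i1, e1⟩ := H1 (δ ^ 2) hδ2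
  obtain ⟨i2, e2⟩ := H2 δ hδ0
  set f1 : ℝ → ℝ := (Set.Iio (δ ^ 2)).indicator (fun y : ℝ => y ^ (-(t / 2))) with hf1
  set f2 : ℝ → ℝ := (Set.Iio δ).indicator (fun y : ℝ => y ^ (-t)) with hf2
  have hmeas : MeasurableSet {p : (Fin s → ℝ) × (Fin m → ℝ) × (Fin d → ℂ) |
      (∑ i, |p.1 i|) + (∑ i, |p.2.1 i|) + (∑ i, ‖p.2.2 i‖ ^ 2) < δ ^ 2} := by
    apply IsOpen.measurableSet
    apply isOpen_lt <;> fun_prop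
  have hint : Integrable (fun p : (Fin s → ℝ) × (Fin m → ℝ) × (Fin d → ℂ) =>
      C0 * ((∏ i, f1 ‖p.1 i‖) * ((∏ i, f1 ‖p.2.1 i‖) * ∏ i, f2 ‖p.2.2 i‖))) := by
    apply Integrable.const_mul
    exact (Integrable.fintype_prod (f := fun _ x => f1 ‖x‖) (fun _ : Fin s => i1)).mul_prod
      ((Integrable.fintype_prod (f := fun _ x => f1 ‖x‖) (fun _ : Fin m => i1)).mul_prod
        (Integrable.fintype_prod (f := fun _ x => f2 ‖x‖) (fun _ : Fin d => i2)))
  have hval : ∫ p : (Fin s → ℝ) × (Fin m → ℝ) × (Fin d → ℂ),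
      C0 * ((∏ i, f1 ‖p.1 i‖) * ((∏ i, f1 ‖p.2.1 i‖) * ∏ i, f2 ‖p.2.2 i‖)) =
      C0 * (c1 ^ s * (c1 ^ m * c2 ^ d)) * δ := by
    rw [integral_const_mul, Measure.volume_eq_prod,
      integral_prod_mul (fun x : Fin s → ℝ => ∏ i, f1 ‖x i‖)
        (fun y : (Fin m → ℝ) × (Fin d → ℂ) => (∏ i, f1 ‖y.1 i‖) * ∏ i, f2 ‖y.2 i‖),
      Measure.volume_eq_prod,
      integral_prod_mul (fun x : Fin m → ℝ => ∏ i, f1 ‖x i‖)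
        (fun y : Fin d → ℂ => ∏ i, f2 ‖y i‖),
      integral_fintype_prod_volume_eq_pow (fun x : ℝ => f1 ‖x‖),
      integral_fintype_prod_volume_eq_pow (fun x : ℝ => f1 ‖x‖),
      integral_fintype_prod_volume_eq_pow (fun x : ℂ => f2 ‖x‖), e1, e2]
    simp only [Fintype.card_fin]
    have hp : (δ ^ 2) ^ (1 - t / 2) = δ ^ (2 - t) := by
      rw [← Real.rpow_natCast, ← Real.rpow_mul hδ0.le]
      congr 1; push_cast; ring
    have hfin : (δ ^ (2 - t)) ^ s * ((δ ^ (2 - t)) ^ m * (δ ^ (2 - t)) ^ d) = δ := by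
      rw [← pow_add, ← pow_add, ← Real.rpow_natCast, ← Real.rpow_mul hδ0.le]
      have : (2 - t) * ((s + (m + d) : ℕ) : ℝ) = 1 := by
        rw [← htQ]; push_cast; ring
      rw [this, Real.rpow_one]
    rw [hp]
    calc _ = C0 * (c1 ^ s * (c1 ^ m * c2 ^ d)) *
          ((δ ^ (2 - t)) ^ s * ((δ ^ (2 - t)) ^ m * (δ ^ (2 - t)) ^ d)) := by
          simp only [mul_pow]; ring
      _ = _ := by rw [hfin]
  have hne1 : ∀ᵐ p : (Fin s → ℝ) × (Fin m → ℝ) × (Fin d → ℂ), ∀ i, p.1 i ≠ 0 := by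
    have : ∀ᵐ x : Fin s → ℝ, ∀ i, x i ≠ 0 :=
      ae_all_iff.2 fun i => Measure.ae_eval_ne (fun _ => volume) i 0
    exact Measure.quasiMeasurePreserving_fst.ae this
  have hne2 : ∀ᵐ p : (Fin s → ℝ) × (Fin m → ℝ) × (Fin d → ℂ), ∀ i, p.2.1 i ≠ 0 := by
    have : ∀ᵐ x : Fin m → ℝ, ∀ i, x i ≠ 0 :=
      ae_all_iff.2 fun i => Measure.ae_eval_ne (fun _ => volume) i 0
    exact Measure.quasiMeasurePreserving_snd.ae (Measure.quasiMeasurePreserving_fst.ae this)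
  have hne3 : ∀ᵐ p : (Fin s → ℝ) × (Fin m → ℝ) × (Fin d → ℂ), ∀ i, p.2.2 i ≠ 0 := by
    have : ∀ᵐ x : Fin d → ℂ, ∀ i, x i ≠ 0 :=
      ae_all_iff.2 fun i => Measure.ae_eval_ne (fun _ => volume) i 0
    exact Measure.quasiMeasurePreserving_snd.ae (Measure.quasiMeasurePreserving_snd.ae this)
  rw [← integral_indicator hmeas]
  have hf1n : ∀ y : ℝ, 0 ≤ f1 ‖y‖ := fun y =>
    Set.indicator_apply_nonneg fun _ => Real.rpow_nonneg (norm_nonneg _) _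
  have hf2n : ∀ y : ℂ, 0 ≤ f2 ‖y‖ := fun y =>
    Set.indicator_apply_nonneg fun _ => Real.rpow_nonneg (norm_nonneg _) _
  refine (integral_mono_of_nonneg ?_ hint ?_).trans ?_
  · refine Filter.Eventually.of_forall fun p => Set.indicator_nonneg (fun x _ => ?_) p
    have : 0 ≤ Real.sqrt ε := Real.sqrt_nonneg _
    positivity
  · filter_upwards [hne1, hne2, hne3] with p h1 h2 h3
    refine Set.indicator_apply_le' (fun hp => ?_) (fun _ => ?_)
    · obtain ⟨ρ, η, w⟩ := p
      simp only [Set.mem_ofPred_eq] at hp h1 h2 h3 ⊢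
      have n1 : 0 ≤ ∑ i, |ρ i| := by positivity
      have n2 : 0 ≤ ∑ i, |η i| := by positivity
      have n3 : 0 ≤ ∑ i, ‖w i‖ ^ 2 := by positivity
      have hδ21 : δ ^ 2 < 1 := by nlinarith
      have b1 : ∀ i, |ρ i| < δ ^ 2 := fun i => by
        have := Finset.single_le_sum (f := fun i => |ρ i|) (fun j _ => abs_nonneg _)
          (Finset.mem_univ i)
        linarith
      have b2 : ∀ i, |η i| < δ ^ 2 := fun i => by
        have := Finset.single_le_sum (f := fun i => |η i|) (fun j _ => abs_nonneg _)
          (Finset.mem_univ i)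
        linarith
      have b3 : ∀ i, ‖w i‖ < δ := fun i => by
        have := Finset.single_le_sum (f := fun i => ‖w i‖ ^ 2) (fun j _ => by positivity)
          (Finset.mem_univ i)
        exact lt_of_pow_lt_pow_left₀ 2 hδ0.le (by linarith)
      have sq : ∀ x : ℝ, 0 ≤ x → x ≤ 1 → x ≤ √x := fun x h0 h1 =>
        Real.le_sqrt_of_sq_le (by nlinarith)
      have sq1 : ∀ x : ℝ, x ≤ 1 → √x ≤ 1 := fun x h1 => Real.sqrt_le_one.2 h1
      have g1 : ∑ i, |ρ i| ≤ ∑ i, √|ρ i| :=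
        Finset.sum_le_sum fun i _ => sq _ (abs_nonneg _) ((b1 i).trans hδ21).le
      have g2 : ∑ i, |η i| ≤ ∑ i, √|η i| :=
        Finset.sum_le_sum fun i _ => sq _ (abs_nonneg _) ((b2 i).trans hδ21).le
      have g3 : ε ≤ √ε := sq _ hε0.le hε1.le
      have l0 : √ε ≤ 1 := sq1 _ hε1.le
      have l1 : ∑ i, √|ρ i| ≤ s := by
        simpa using Finset.sum_le_card_nsmul Finset.univ (fun i => √|ρ i|) 1
          fun i _ => sq1 _ ((b1 i).trans hδ21).le
      have l2 : ∑ i, √|η i| ≤ m := by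
        simpa using Finset.sum_le_card_nsmul Finset.univ (fun i => √|η i|) 1
          fun i _ => sq1 _ ((b2 i).trans hδ21).le
      have l3 : ∑ i, ‖w i‖ ≤ d := by
        simpa using Finset.sum_le_card_nsmul Finset.univ (fun i => ‖w i‖) 1
          fun i _ => ((b3 i).trans hδ1).le
      have p0 : 0 ≤ √ε := Real.sqrt_nonneg _
      have p1 : 0 ≤ ∑ i, √|ρ i| := by positivity
      have p2 : 0 ≤ ∑ i, √|η i| := by positivity
      have p3 : 0 ≤ ∑ i, ‖w i‖ := by positivity
      have hP1 : 0 < ∏ i, √|ρ i| := Finset.prod_pos fun i _ =>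
        Real.sqrt_pos.2 (abs_pos.2 (h1 i))
      have hP2 : 0 < ∏ i, √|η i| := Finset.prod_pos fun i _ =>
        Real.sqrt_pos.2 (abs_pos.2 (h2 i))
      have hP3 : 0 < ∏ i, ‖w i‖ := Finset.prod_pos fun i _ => norm_pos_iff.2 (h3 i)
      have main := pw_bound (ε + (∑ i, |ρ i|) + (∑ i, |η i|) + ∑ i, ‖w i‖)
        (√ε + (∑ i, √|ρ i|) + (∑ i, √|η i|) + ∑ i, ‖w i‖)
        (∏ i, ‖w i‖) ((∏ i, √|ρ i|) * ∏ i, √|η i|) L t d (s + m) k h hd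
        (by linarith) (by linarith) (by linarith) hL hP3
        (by
          simpa using prod_le_sum_pow (fun i => ‖w i‖) (fun i => norm_nonneg _)
            (ε + (∑ i, |ρ i|) + (∑ i, |η i|) + ∑ i, ‖w i‖) (by linarith))
        (mul_pos hP1 hP2)
        (by
          rw [pow_add]
          refine mul_le_mul ?_ ?_ hP2.le (by positivity)
          · simpa using prod_le_sum_pow (fun i => √|ρ i|) (fun i => Real.sqrt_nonneg _)
              (√ε + (∑ i, √|ρ i|) + (∑ i, √|η i|) + ∑ i, ‖w i‖) (by linarith)
          · simpa using prod_le_sum_pow (fun i => √|η i|) (fun i => Real.sqrt_nonneg _)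
              (√ε + (∑ i, √|ρ i|) + (∑ i, √|η i|) + ∑ i, ‖w i‖) (by linarith))
        ht (by push_cast at hk; linarith) (by push_cast at hkh ⊢; linarith)
      rw [← hC0def] at main
      refine main.trans (le_of_eq ?_)
      have q : ∀ x : ℝ, |x| < δ ^ 2 → f1 ‖x‖ = (√|x|) ^ (-t) := fun x hx => by
        rw [hf1, Real.norm_eq_abs, Set.indicator_of_mem (show |x| ∈ Set.Iio (δ ^ 2) from hx),
          Real.sqrt_eq_rpow, ← Real.rpow_mul (abs_nonneg _)]
        congr 1; ring
      have q2 : ∀ x : ℂ, ‖x‖ < δ → f2 ‖x‖ = ‖x‖ ^ (-t) := fun x hx => by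
        rw [hf2, Set.indicator_of_mem (show ‖x‖ ∈ Set.Iio δ from hx)]
      rw [Finset.prod_congr rfl fun i _ => q (ρ i) (b1 i),
        Finset.prod_congr rfl fun i _ => q (η i) (b2 i),
        Finset.prod_congr rfl fun i _ => q2 (w i) (b3 i),
        Real.finsetProd_rpow _ _ (fun i _ => Real.sqrt_nonneg _),
        Real.finsetProd_rpow _ _ (fun i _ => Real.sqrt_nonneg _),
        Real.finsetProd_rpow _ _ (fun i _ => norm_nonneg _),
        Real.mul_rpow hP1.le hP2.le]
      ring
    · exact mul_nonneg hC0.le (mul_nonneg (Finset.prod_nonneg fun i _ => hf1n _)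
        (mul_nonneg (Finset.prod_nonneg fun i _ => hf1n _)
          (Finset.prod_nonneg fun i _ => hf2n _)))
  · rw [hval]
    nlinarith
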